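/- Assume W is a double-well potential (W ∈ C¹(ℝ), W(-1) = W(1) = 0, W(s) > 0 for s ≠ ±1), a : ℝ → ℝ satisfies 0 < a₁ ≤ a(t) ≤ a₂ for all t ∈ ℝ, and there exists b ∈ L^∞(ℝ), T-periodic for some T > 0, with a(t) ≤ b(t) for every t ∈ ℝ and lim_{|t|→∞}(b(t) − a(t)) = 0. Then L_a attains its infimum at some u_a ∈ X₁; moreover, u_a is a C¹ ∩ W^{2,2}_loc solution of (u'/√(1 − |u'|²))' = a(t) W'(u) on ℝ with lim_{t→±∞}(u(t), u'(t)) = (±1, 0), and ‖u_a'‖_{L^∞(ℝ)} < 1. -/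

import Mathlib

open MeasureTheory Filter Topology Set
open scoped ENNReal

noncomputable section

/-- The class `X₁`: `W^{1,∞}(ℝ)` functions with `‖u'‖_{L^∞} ≤ 1` and `u(t) → ±1` as
`t → ±∞`. -/
def memX1 (u : ℝ → ℝ) : Prop :=
  LipschitzWith 1 u ∧ Tendsto u atTop (𝓝 (1:ℝ)) ∧ Tendsto u atBot (𝓝 (-1:ℝ))

/-- `W` is a double-well potential: `C¹`, vanishing exactly at `±1` and positive elsewhere. -/
def DoubleWell (W : ℝ → ℝ) : Prop :=
  ContDiff ℝ 1 W ∧ W (-1) = 0 ∧ W 1 = 0 ∧ ∀ s : ℝ, s ≠ -1 → s ≠ 1 → 0 < W s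

/-- The action functional `L_a(u) = ∫_ℝ (1 - √(1 - |u'|²) + a(t) W(u)) dt`. -/
def LaE (a W u : ℝ → ℝ) : ℝ≥0∞ :=
  ∫⁻ t : ℝ, ENNReal.ofReal (1 - Real.sqrt (1 - (deriv u t) ^ 2) + a t * W (u t))

/-- `u` is a `C¹ ∩ W^{2,2}_loc` solution of `(u'/√(1-|u'|²))' = a(t) W'(u)` on `ℝ`,
expressed through the integrated form of the equation. -/
def SolvesEL (a W u : ℝ → ℝ) : Prop :=
  ContDiff ℝ 1 u ∧
  ∀ s t : ℝ,
    deriv u t / Real.sqrt (1 - (deriv u t) ^ 2)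
      - deriv u s / Real.sqrt (1 - (deriv u s) ^ 2)
    = ∫ r in s..t, a r * deriv W (u r)

/-- The kinetic density `1 - √(1 - p²)`. -/
def kineticDensity (p : ℝ) : ℝ := 1 - Real.sqrt (1 - p ^ 2)

lemma kineticDensity_nonneg (p : ℝ) : 0 ≤ kineticDensity p := by
  unfold kineticDensity
  have : Real.sqrt (1 - p ^ 2) ≤ 1 := Real.sqrt_le_one.mpr (by nlinarith [sq_nonneg p])
  linarith

lemma kineticDensity_le_one (p : ℝ) : kineticDensity p ≤ 1 := by
  unfold kineticDensity
  linarith [Real.sqrt_nonneg (1 - p ^ 2)]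

lemma continuous_kineticDensity : Continuous kineticDensity := by
  unfold kineticDensity
  fun_prop

lemma kineticDensity_mono {p q : ℝ} (h : |p| ≤ |q|) : kineticDensity p ≤ kineticDensity q := by
  unfold kineticDensity
  have := Real.sqrt_le_sqrt (show 1 - q ^ 2 ≤ 1 - p ^ 2 by linarith [sq_le_sq.mpr h])
  linarith

lemma convexOn_kineticDensity : ConvexOn ℝ (Icc (-1) 1) kineticDensity := by
  have hsq : ConcaveOn ℝ (Icc (-1 : ℝ) 1) (fun p : ℝ => 1 - p ^ 2) :=
    (concaveOn_const 1 (convex_Icc _ _)).sub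
      ((even_two.convexOn_pow (𝕜 := ℝ)).subset (subset_univ _) (convex_Icc _ _))
  refine (convexOn_const 1 (convex_Icc _ _)).sub ⟨convex_Icc _ _, fun x hx y hy c d hc hd hcd => ?_⟩
  have h1 := hsq.2 hx hy hc hd hcd
  have hx' : (0 : ℝ) ≤ 1 - x ^ 2 := by nlinarith [hx.1, hx.2]
  have hy' : (0 : ℝ) ≤ 1 - y ^ 2 := by nlinarith [hy.1, hy.2]
  exact (Real.strictConcaveOn_sqrt.concaveOn.2 hx' hy' hc hd hcd).trans (Real.sqrt_le_sqrt h1)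

/-- The inverse of the relativistic momentum `p ↦ p / √(1 - p²)`. -/
def velocityOfMomentum (y : ℝ) : ℝ := y / Real.sqrt (1 + y ^ 2)

lemma continuous_velocityOfMomentum : Continuous velocityOfMomentum := by
  unfold velocityOfMomentum
  exact continuous_id.div (by fun_prop) fun y => (Real.sqrt_pos.mpr (by positivity)).ne'

lemma one_sub_velocityOfMomentum_sq (y : ℝ) :
    1 - velocityOfMomentum y ^ 2 = (1 / Real.sqrt (1 + y ^ 2)) ^ 2 := by
  have h : (0 : ℝ) < 1 + y ^ 2 := by positivity
  unfold velocityOfMomentum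
  rw [div_pow, div_pow, Real.sq_sqrt h.le]
  field_simp
  ring

lemma sqrt_one_sub_velocityOfMomentum_sq (y : ℝ) :
    Real.sqrt (1 - velocityOfMomentum y ^ 2) = 1 / Real.sqrt (1 + y ^ 2) := by
  rw [one_sub_velocityOfMomentum_sq, Real.sqrt_sq (by positivity)]

lemma abs_velocityOfMomentum_lt_one (y : ℝ) : |velocityOfMomentum y| < 1 := by
  rw [← sq_lt_one_iff_abs_lt_one]
  have h : 0 < Real.sqrt (1 + y ^ 2) := Real.sqrt_pos.mpr (by positivity)
  have := one_sub_velocityOfMomentum_sq y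
  have : 0 < (1 / Real.sqrt (1 + y ^ 2)) ^ 2 := by positivity
  linarith

lemma momentum_velocityOfMomentum (y : ℝ) :
    velocityOfMomentum y / Real.sqrt (1 - velocityOfMomentum y ^ 2) = y := by
  have h : 0 < Real.sqrt (1 + y ^ 2) := Real.sqrt_pos.mpr (by positivity)
  rw [sqrt_one_sub_velocityOfMomentum_sq]
  unfold velocityOfMomentum
  field_simp

lemma velocityOfMomentum_momentum {p : ℝ} (hp : |p| < 1) :
    velocityOfMomentum (p / Real.sqrt (1 - p ^ 2)) = p := by
  have h : 0 < 1 - p ^ 2 := by linarith [(sq_lt_one_iff_abs_lt_one p).mpr hp]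
  unfold velocityOfMomentum
  have hs := Real.sqrt_pos.mpr h
  have : 1 + (p / Real.sqrt (1 - p ^ 2)) ^ 2 = (1 / Real.sqrt (1 - p ^ 2)) ^ 2 := by
    rw [div_pow, div_pow, Real.sq_sqrt h.le]
    field_simp
    ring
  rw [this, Real.sqrt_sq (by positivity)]
  field_simp

lemma velocityOfMomentum_injective : Function.Injective velocityOfMomentum := fun x y h => by
  rw [← momentum_velocityOfMomentum x, h, momentum_velocityOfMomentum]

lemma velocityOfMomentum_strictMono : StrictMono velocityOfMomentum := by
  rcases continuous_velocityOfMomentum.strictMono_of_inj velocityOfMomentum_injective with h | h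
  · exact h
  · have := h (zero_lt_one' ℝ)
    have h2 : 0 < velocityOfMomentum 1 := by unfold velocityOfMomentum; positivity
    simp only [velocityOfMomentum, zero_div] at this h2
    linarith

/-- Fenchel–Young inequality for the kinetic density, with its equality case. -/
lemma fenchel_kineticDensity {q : ℝ} (hq : |q| ≤ 1) (y : ℝ) :
    kineticDensity (velocityOfMomentum y) - y * velocityOfMomentum y ≤ kineticDensity q - y * q ∧
      (kineticDensity (velocityOfMomentum y) - y * velocityOfMomentum y =
        kineticDensity q - y * q → q = velocityOfMomentum y) := by
  have hq2 : 0 ≤ 1 - q ^ 2 := by linarith [(sq_le_one_iff_abs_le_one q).mpr hq]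
  have h0 : (0 : ℝ) < 1 + y ^ 2 := by positivity
  set R := Real.sqrt (1 + y ^ 2) with hR
  have hRp : 0 < R := Real.sqrt_pos.mpr h0
  have hR2 : R ^ 2 = 1 + y ^ 2 := Real.sq_sqrt h0.le
  set s := Real.sqrt (1 - q ^ 2) with hs
  have hs2 : s ^ 2 = 1 - q ^ 2 := Real.sq_sqrt hq2
  have hL : kineticDensity (velocityOfMomentum y) - y * velocityOfMomentum y = 1 - R := by
    unfold kineticDensity
    rw [sqrt_one_sub_velocityOfMomentum_sq, ← hR]
    unfold velocityOfMomentum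
    rw [← hR]
    field_simp
    linarith
  have hid : (s + y * q) ^ 2 + (q - y * s) ^ 2 = R ^ 2 := by
    have : (s + y * q) ^ 2 + (q - y * s) ^ 2 = (s ^ 2 + q ^ 2) * (1 + y ^ 2) := by ring
    rw [this, hs2, hR2]; ring
  have hK : kineticDensity q - y * q = 1 - (s + y * q) := by unfold kineticDensity; ring
  rw [hL, hK]
  refine ⟨?_, fun h => ?_⟩
  · have : s + y * q ≤ R := abs_le_of_sq_le_sq' (by nlinarith [sq_nonneg (q - y * s)]) hRp.le |>.2
    linarith
  · have h1 : s + y * q = R := by linarith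
    have h2 : (q - y * s) ^ 2 = 0 := by rw [h1] at hid; linarith
    have h3 : q = y * s := by linarith [pow_eq_zero_iff (two_ne_zero) |>.mp h2]
    have h4 : s * R = 1 := by
      have : s * (1 + y ^ 2) = R := by rw [← h1, h3]; ring
      rw [← hR2] at this
      have : s * R * R = 1 * R := by linarith [this, show s * R ^ 2 = s * R * R by ring]
      exact mul_right_cancel₀ hRp.ne' this
    unfold velocityOfMomentum
    rw [← hR, h3, eq_div_iff hRp.ne']
    linear_combination y * h4

lemma LipschitzWith.abs_deriv_le_one {u : ℝ → ℝ} (hu : LipschitzWith 1 u) (t : ℝ) :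
    |deriv u t| ≤ 1 := by
  simpa using norm_deriv_le_of_lipschitz hu (x₀ := t)

lemma LipschitzWith.abs_sub_le {u : ℝ → ℝ} (hu : LipschitzWith 1 u) (s t : ℝ) :
    |u s - u t| ≤ |s - t| := by
  simpa [Real.dist_eq] using hu.dist_le_mul s t

lemma LipschitzWith.intervalIntegrable_deriv_real {u : ℝ → ℝ} (hu : LipschitzWith 1 u)
    (s t : ℝ) : IntervalIntegrable (deriv u) volume s t :=
  (hu.lipschitzOnWith (s := uIcc s t)).absolutelyContinuousOnInterval.intervalIntegrable_deriv

lemma LipschitzWith.integral_deriv_eq_sub {u : ℝ → ℝ} (hu : LipschitzWith 1 u) (s t : ℝ) :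
    ∫ r in s..t, deriv u r = u t - u s :=
  (hu.lipschitzOnWith (s := uIcc s t)).absolutelyContinuousOnInterval.integral_deriv_eq_sub

lemma kineticDensity_slope_le {u : ℝ → ℝ} (hu : LipschitzWith 1 u) (t : ℝ) {h : ℝ} (hh : 0 < h) :
    kineticDensity ((u (t + h) - u t) / h) ≤
      ∫ σ in Ioc (0 : ℝ) 1, kineticDensity (deriv u (t + h * σ)) := by
  have h1 : (u (t + h) - u t) / h = ∫ σ in Ioc (0 : ℝ) 1, deriv u (t + h * σ) := by
    rw [← intervalIntegral.integral_of_le zero_le_one]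
    have := intervalIntegral.smul_integral_comp_add_mul (deriv u) (a := 0) (b := 1) h t
    rw [mul_zero, mul_one, add_zero, hu.integral_deriv_eq_sub, smul_eq_mul] at this
    rw [← this]
    field_simp
  have hm : Measurable fun σ : ℝ => deriv u (t + h * σ) :=
    (measurable_deriv u).comp (by fun_prop)
  have : IsProbabilityMeasure (volume.restrict (Ioc (0 : ℝ) 1)) := ⟨by simp⟩
  rw [h1]
  refine convexOn_kineticDensity.map_integral_le continuous_kineticDensity.continuousOn
    isClosed_Icc (ae_of_all _ fun σ => abs_le.mp (hu.abs_deriv_le_one _)) ?_ ?_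
  · exact Integrable.of_bound hm.aestronglyMeasurable 1 (ae_of_all _ fun σ =>
      hu.abs_deriv_le_one _)
  · exact Integrable.of_bound (continuous_kineticDensity.measurable.comp hm).aestronglyMeasurable 1
      (ae_of_all _ fun σ => by
        rw [Function.comp_apply, Real.norm_of_nonneg (kineticDensity_nonneg _)]
        exact kineticDensity_le_one _)

lemma lintegral_kineticDensity_slope_le {u : ℝ → ℝ} (hu : LipschitzWith 1 u) {h : ℝ}
    (hh : 0 < h) :
    ∫⁻ t, ENNReal.ofReal (kineticDensity ((u (t + h) - u t) / h)) ≤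
      ∫⁻ t, ENNReal.ofReal (kineticDensity (deriv u t)) := by
  have hmeas : Measurable fun t => ENNReal.ofReal (kineticDensity (deriv u t)) :=
    (continuous_kineticDensity.measurable.comp (measurable_deriv u)).ennreal_ofReal
  calc
    _ ≤ ∫⁻ t, ∫⁻ σ in Ioc (0 : ℝ) 1, ENNReal.ofReal (kineticDensity (deriv u (t + h * σ))) := by
      refine lintegral_mono fun t => ?_
      have hm : Measurable fun σ : ℝ => kineticDensity (deriv u (t + h * σ)) :=
        continuous_kineticDensity.measurable.comp ((measurable_deriv u).comp (by fun_prop))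
      rw [← ofReal_integral_eq_lintegral_ofReal
        (Integrable.of_bound hm.aestronglyMeasurable 1 (ae_of_all _ fun σ => by
          rw [Real.norm_of_nonneg (kineticDensity_nonneg _)]
          exact kineticDensity_le_one _))
        (ae_of_all _ fun σ => kineticDensity_nonneg _)]
      exact ENNReal.ofReal_le_ofReal (kineticDensity_slope_le hu t hh)
    _ = ∫⁻ σ in Ioc (0 : ℝ) 1, ∫⁻ t, ENNReal.ofReal (kineticDensity (deriv u (t + h * σ))) := by
      refine lintegral_lintegral_swap (Measurable.aemeasurable ?_)
      exact hmeas.comp (by fun_prop : Measurable fun p : ℝ × ℝ => p.1 + h * p.2)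
    _ = _ := by
      have hshift : ∀ σ, ∫⁻ t, ENNReal.ofReal (kineticDensity (deriv u (t + h * σ))) =
          ∫⁻ t, ENNReal.ofReal (kineticDensity (deriv u t)) := fun σ =>
        lintegral_add_right_eq_self
          (fun t => ENNReal.ofReal (kineticDensity (deriv u t))) (h * σ)
      simp only [hshift]
      simp

lemma LaE_eq (a W u : ℝ → ℝ) :
    LaE a W u = ∫⁻ t, ENNReal.ofReal (kineticDensity (deriv u t) + a t * W (u t)) := rfl

/-- Lower semicontinuity of the action under pointwise convergence of curves and weights. -/
lemma LaE_le_of_tendsto {W : ℝ → ℝ} (hWc : Continuous W) (hW0 : ∀ s, 0 ≤ W s)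
    {α : ℕ → ℝ → ℝ} {a : ℝ → ℝ} {v : ℕ → ℝ → ℝ} {u : ℝ → ℝ}
    (hαm : ∀ n, Measurable (α n)) (hα0 : ∀ n t, 0 ≤ α n t) (ham : Measurable a)
    (hα : ∀ t, Tendsto (fun n => α n t) atTop (𝓝 (a t)))
    (hv1 : ∀ n, LipschitzWith 1 (v n)) (hu1 : LipschitzWith 1 u)
    (hv : ∀ t, Tendsto (fun n => v n t) atTop (𝓝 (u t))) {m : ℝ≥0∞}
    (hm : liminf (fun n => LaE (α n) W (v n)) atTop ≤ m) : LaE a W u ≤ m := by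
  have hpot : ∀ {f g : ℝ → ℝ}, Measurable f → Continuous g → Measurable fun t => f t * W (g t) :=
    fun hf hg => hf.mul (hWc.comp hg).measurable
  have hslope_meas : ∀ {g : ℝ → ℝ} (h : ℝ), Continuous g →
      Measurable fun t => kineticDensity ((g (t + h) - g t) / h) := fun {g} h hg =>
    (continuous_kineticDensity.comp
      (by fun_prop : Continuous fun t => (g (t + h) - g t) / h)).measurable
  have hstep : ∀ h : ℝ, 0 < h →
      ∫⁻ t, ENNReal.ofReal (kineticDensity ((u (t + h) - u t) / h) + a t * W (u t)) ≤ m := by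
    intro h hh
    refine le_trans ?_ hm
    have hle : ∀ n, ∫⁻ t, ENNReal.ofReal
        (kineticDensity ((v n (t + h) - v n t) / h) + α n t * W (v n t)) ≤
        LaE (α n) W (v n) := by
      intro n
      rw [LaE_eq]
      simp_rw [fun t p => ENNReal.ofReal_add (kineticDensity_nonneg p)
        (mul_nonneg (hα0 n t) (hW0 (v n t)))]
      rw [lintegral_add_right _ (hpot (hαm n) (hv1 n).continuous).ennreal_ofReal,
        lintegral_add_right _ (hpot (hαm n) (hv1 n).continuous).ennreal_ofReal]
      exact add_le_add (lintegral_kineticDensity_slope_le (hv1 n) hh) le_rfl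
    refine le_trans ?_ (liminf_le_liminf (Eventually.of_forall hle))
    refine le_trans (lintegral_mono fun t => ?_) (lintegral_liminf_le fun n =>
      ((hslope_meas h (hv1 n).continuous).add (hpot (hαm n) (hv1 n).continuous)).ennreal_ofReal)
    refine (Tendsto.liminf_eq ?_).ge
    refine (ENNReal.continuous_ofReal.tendsto _).comp (Tendsto.add ?_ ?_)
    · exact (continuous_kineticDensity.tendsto _).comp (((hv _).sub (hv _)).div_const h)
    · exact (hα t).mul ((hWc.tendsto _).comp (hv t))
  have hε : Tendsto (fun n : ℕ => (1 : ℝ) / (n + 1)) atTop (𝓝[≠] 0) :=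
    tendsto_nhdsWithin_iff.mpr ⟨tendsto_one_div_add_atTop_nhds_zero_nat,
      Eventually.of_forall fun n => (by positivity : (1 : ℝ) / (n + 1) ≠ 0)⟩
  rw [LaE_eq]
  calc
    _ ≤ ∫⁻ t, liminf (fun n : ℕ => ENNReal.ofReal (kineticDensity
        ((u (t + 1 / ((n : ℝ) + 1)) - u t) / (1 / ((n : ℝ) + 1))) + a t * W (u t))) atTop := by
      refine lintegral_mono_ae ?_
      filter_upwards [hu1.ae_differentiableAt_real] with t ht
      refine (Tendsto.liminf_eq ?_).ge
      refine (ENNReal.continuous_ofReal.tendsto _).comp (Tendsto.add ?_ tendsto_const_nhds)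
      refine (continuous_kineticDensity.tendsto _).comp ?_
      have := (hasDerivAt_iff_tendsto_slope_zero.mp ht.hasDerivAt).comp hε
      refine this.congr fun n => ?_
      simp [div_eq_inv_mul]
    _ ≤ liminf (fun n : ℕ => ∫⁻ t, ENNReal.ofReal (kineticDensity
        ((u (t + 1 / ((n : ℝ) + 1)) - u t) / (1 / ((n : ℝ) + 1))) + a t * W (u t))) atTop :=
      lintegral_liminf_le fun n =>
        ((hslope_meas _ hu1.continuous).add (hpot ham hu1.continuous)).ennreal_ofReal
    _ ≤ m := by
      refine le_trans (liminf_le_liminf (Eventually.of_forall fun n =>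
        hstep (1 / ((n : ℝ) + 1)) (by positivity))) ?_
      simp

/-- A function which follows `f` up to time `c` and `g` afterwards. -/
def glue (c : ℝ) (f g : ℝ → ℝ) (t : ℝ) : ℝ := if t ≤ c then f t else g t

lemma glue_of_le {c t : ℝ} (f g : ℝ → ℝ) (h : t ≤ c) : glue c f g t = f t := if_pos h

lemma glue_of_lt {c t : ℝ} (f g : ℝ → ℝ) (h : c < t) : glue c f g t = g t := if_neg h.not_ge

lemma glue_of_ge {c t : ℝ} {f g : ℝ → ℝ} (hc : f c = g c) (h : c ≤ t) : glue c f g t = g t := by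
  rcases h.eq_or_lt with rfl | h
  · rw [glue_of_le f g le_rfl, hc]
  · exact glue_of_lt f g h

lemma lipschitzWith_one_of_le {f : ℝ → ℝ} (h : ∀ s t, s ≤ t → |f t - f s| ≤ t - s) :
    LipschitzWith 1 f := by
  refine LipschitzWith.of_dist_le_mul fun x y => ?_
  rw [NNReal.coe_one, one_mul, Real.dist_eq, Real.dist_eq]
  rcases le_total x y with hxy | hxy
  · rw [abs_sub_comm, abs_sub_comm x y, abs_of_nonneg (sub_nonneg.mpr hxy)]
    exact h x y hxy
  · rw [abs_of_nonneg (sub_nonneg.mpr hxy)]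
    exact h y x hxy

lemma LipschitzWith.abs_sub_le_of_le {u : ℝ → ℝ} (hu : LipschitzWith 1 u) {s t : ℝ} (h : s ≤ t) :
    |u t - u s| ≤ t - s := by
  simpa [abs_of_nonneg (sub_nonneg.mpr h)] using hu.abs_sub_le t s

lemma LipschitzWith.glue {c : ℝ} {f g : ℝ → ℝ} (hf : LipschitzWith 1 f) (hg : LipschitzWith 1 g)
    (hc : f c = g c) : LipschitzWith 1 (glue c f g) := by
  refine lipschitzWith_one_of_le fun s t hst => ?_
  rcases le_total t c with ht | ht
  · rw [glue_of_le f g ht, glue_of_le f g (hst.trans ht)]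
    exact hf.abs_sub_le_of_le hst
  rcases le_total s c with hs | hs
  · rw [glue_of_ge hc ht, glue_of_le f g hs]
    have h1 := hf.abs_sub_le_of_le hs
    have h2 := hg.abs_sub_le_of_le ht
    rw [hc] at h1
    rw [abs_le] at h1 h2 ⊢
    constructor <;> linarith [h1.1, h1.2, h2.1, h2.2]
  · rw [glue_of_ge hc ht, glue_of_ge hc hs]
    exact hg.abs_sub_le_of_le hst

lemma deriv_eq_of_eqOn_open {f g : ℝ → ℝ} {U : Set ℝ} (hU : IsOpen U) (h : EqOn f g U) {t : ℝ}
    (ht : t ∈ U) : deriv f t = deriv g t :=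
  (h.eventuallyEq_of_mem (hU.mem_nhds ht)).deriv_eq

lemma DoubleWell.continuous {W : ℝ → ℝ} (hW : DoubleWell W) : Continuous W := hW.1.continuous

lemma DoubleWell.nonneg {W : ℝ → ℝ} (hW : DoubleWell W) (s : ℝ) : 0 ≤ W s := by
  obtain ⟨-, h1, h2, h3⟩ := hW
  by_cases hs : s = -1
  · rw [hs, h1]
  by_cases hs' : s = 1
  · rw [hs', h2]
  exact (h3 s hs hs').le

/-- A double-well potential is bounded away from `0` on compact intervals avoiding the wells. -/
lemma DoubleWell.exists_pos_le {W : ℝ → ℝ} (hW : DoubleWell W) {x y : ℝ}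
    (h : ∀ s ∈ Icc x y, s ≠ -1 ∧ s ≠ 1) : ∃ μ > 0, ∀ s ∈ Icc x y, μ ≤ W s := by
  rcases (Icc x y).eq_empty_or_nonempty with he | hne
  · exact ⟨1, one_pos, fun s hs => by simp [he] at hs⟩
  obtain ⟨s₀, hs₀, hmin⟩ := isCompact_Icc.exists_isMinOn hne hW.continuous.continuousOn
  exact ⟨W s₀, hW.2.2.2 s₀ (h s₀ hs₀).1 (h s₀ hs₀).2, fun s hs => hmin hs⟩

lemma measurable_lagrangian {a W u : ℝ → ℝ} (ha : Measurable a) (hW : Continuous W)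
    (hu : Continuous u) : Measurable fun t => kineticDensity (deriv u t) + a t * W (u t) :=
  (continuous_kineticDensity.measurable.comp (measurable_deriv u)).add
    (ha.mul (hW.comp hu).measurable)

lemma LaE_comp_add_right (a W u : ℝ → ℝ) (c : ℝ) :
    LaE (fun t => a (t + c)) W (fun t => u (t + c)) = LaE a W u := by
  simp only [LaE_eq, deriv_comp_add_const]
  exact lintegral_add_right_eq_self
    (fun t => ENNReal.ofReal (kineticDensity (deriv u t) + a t * W (u t))) c

lemma abs_deriv_comp_le {f u : ℝ → ℝ} (hf : LipschitzWith 1 f) {t : ℝ}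
    (hu : DifferentiableAt ℝ u t) (hfu : DifferentiableAt ℝ (fun s => f (u s)) t) :
    |deriv (fun s => f (u s)) t| ≤ |deriv u t| := by
  have h1 := (hasDerivAt_iff_tendsto_slope_zero.mp hu.hasDerivAt).abs
  have h2 := (hasDerivAt_iff_tendsto_slope_zero.mp hfu.hasDerivAt).abs
  refine le_of_tendsto_of_tendsto' h2 h1 fun h => ?_
  rw [smul_eq_mul, smul_eq_mul, abs_mul, abs_mul]
  exact mul_le_mul_of_nonneg_left (hf.abs_sub_le _ _) (abs_nonneg _)

/-- Truncating a curve to `[-1, 1]` does not increase the action. -/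
lemma exists_truncation {a W : ℝ → ℝ} (hW : DoubleWell W) (ha : ∀ t, 0 ≤ a t) {u : ℝ → ℝ}
    (hu : memX1 u) : ∃ v, memX1 v ∧ (∀ t, |v t| ≤ 1) ∧ LaE a W v ≤ LaE a W u := by
  have hf : LipschitzWith 1 fun x : ℝ => max (-1) (min 1 x) :=
    (LipschitzWith.id.const_min 1).const_max (-1)
  have hv : LipschitzWith 1 fun t => max (-1) (min 1 (u t)) := by
    simpa [Function.comp_def] using hf.comp hu.1
  refine ⟨fun t => max (-1) (min 1 (u t)), ⟨hv, ?_, ?_⟩, fun t => ?_, ?_⟩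
  · simpa [Function.comp_def] using (hf.continuous.tendsto 1).comp hu.2.1
  · simpa [Function.comp_def] using (hf.continuous.tendsto (-1)).comp hu.2.2
  · exact abs_le.mpr ⟨le_max_left _ _, max_le (by norm_num) (min_le_left _ _)⟩
  · refine lintegral_mono_ae ?_
    filter_upwards [hu.1.ae_differentiableAt_real, hv.ae_differentiableAt_real] with t h1 h2
    refine ENNReal.ofReal_le_ofReal (add_le_add
      (kineticDensity_mono (abs_deriv_comp_le hf h1 h2)) (mul_le_mul_of_nonneg_left ?_ (ha t)))
    rcases le_total (u t) 1 with h | h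
    · rcases le_total (-1) (u t) with h' | h'
      · rw [min_eq_right h, max_eq_right h']
      · rw [min_eq_right h, max_eq_left h', hW.2.1]
        exact hW.nonneg _
    · rw [min_eq_left h, max_eq_right (by norm_num), hW.2.2.1]
      exact hW.nonneg _

/-- The initial piece of a curve starting close to `-1` can be replaced by a short ramp. -/
lemma exists_ramp_replacement {a W : ℝ → ℝ} {a₂ M : ℝ} (hW : DoubleWell W)
    (ha₂ : ∀ t, a t ≤ a₂) (ha : ∀ t, 0 ≤ a t) (hM : ∀ x ∈ Icc (-1 : ℝ) 1, W x ≤ M)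
    {u : ℝ → ℝ} (hu1 : LipschitzWith 1 u) (hutop : Tendsto u atTop (𝓝 1)) {s δ : ℝ}
    (hδ0 : 0 ≤ δ) (hδ2 : δ ≤ 2) (hs : u s = -1 + δ) :
    ∃ v, memX1 v ∧ LaE a W v ≤ ENNReal.ofReal (δ * (1 + a₂ * M)) +
      ∫⁻ t in Ioi s, ENNReal.ofReal (kineticDensity (deriv u t) + a t * W (u t)) := by
  set r : ℝ → ℝ := fun t => max (-1) (-1 + δ + (t - s)) with hr
  have hr1 : LipschitzWith 1 r := by
    refine LipschitzWith.const_max ?_ (-1)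
    refine LipschitzWith.of_dist_le_mul fun x y => ?_
    simp [Real.dist_eq]
  have hrs : r s = u s := by
    rw [hs, hr]
    simp only [sub_self, add_zero]
    exact max_eq_right (by linarith)
  have hrlow : ∀ t ≤ s - δ, r t = -1 := fun t ht => max_eq_left (by linarith)
  refine ⟨glue s r u, ⟨hr1.glue hu1 hrs, ?_, ?_⟩, ?_⟩
  · exact hutop.congr' ((eventually_gt_atTop s).mono fun t ht => (glue_of_lt _ _ ht).symm)
  · refine tendsto_const_nhds.congr' ((eventually_le_atBot (s - δ)).mono fun t ht => ?_)
    rw [glue_of_le _ _ (by linarith), hrlow t ht]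
  · rw [LaE_eq, ← lintegral_add_compl _ (measurableSet_Iic (a := s)), compl_Iic]
    have hleft : ∀ t < s, kineticDensity (deriv (glue s r u) t) + a t * W (glue s r u t) =
        kineticDensity (deriv r t) + a t * W (r t) := fun t ht => by
      rw [glue_of_le _ _ ht.le, deriv_eq_of_eqOn_open isOpen_Iio
        (fun x (hx : x < s) => glue_of_le r u hx.le) ht]
    refine add_le_add ?_ (le_of_eq ?_)
    · have h0 : 0 ≤ a₂ * M := mul_nonneg ((ha 0).trans (ha₂ 0))
        ((hW.nonneg 0).trans (hM 0 (by norm_num)))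
      calc
        _ = ∫⁻ t in Iio s, ENNReal.ofReal
            (kineticDensity (deriv (glue s r u) t) + a t * W (glue s r u t)) := by
          rw [Measure.restrict_congr_set Iio_ae_eq_Iic]
        _ ≤ ∫⁻ t in Iio s, (Ico (s - δ) s).indicator
            (fun _ => ENNReal.ofReal (1 + a₂ * M)) t := by
          refine setLIntegral_mono
            (Measurable.indicator measurable_const measurableSet_Ico) fun t ht => ?_
          rw [mem_Iio] at ht
          rw [hleft t ht]
          by_cases h : s - δ ≤ t
          · rw [indicator_of_mem (mem_Ico.mpr ⟨h, ht⟩)]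
            refine ENNReal.ofReal_le_ofReal (add_le_add (kineticDensity_le_one _) ?_)
            have hrt : r t ∈ Icc (-1 : ℝ) 1 :=
              ⟨le_max_left _ _, max_le (by norm_num) (by linarith)⟩
            exact mul_le_mul (ha₂ t) (hM _ hrt)
              (hW.nonneg _) ((ha 0).trans (ha₂ 0))
          · rw [not_le] at h
            rw [hrlow t h.le, deriv_eq_of_eqOn_open (g := fun _ => -1) isOpen_Iio
              (fun x (hx : x < s - δ) => hrlow x hx.le) h, hW.2.1]
            simp [kineticDensity]
        _ ≤ ∫⁻ t, (Ico (s - δ) s).indicator (fun _ => ENNReal.ofReal (1 + a₂ * M)) t :=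
          setLIntegral_le_lintegral _ _
        _ = _ := by
          rw [lintegral_indicator measurableSet_Ico, lintegral_const]
          rw [Measure.restrict_apply_univ, Real.volume_Ico, sub_sub_cancel, mul_comm,
            ← ENNReal.ofReal_mul hδ0]
    · refine setLIntegral_congr_fun measurableSet_Ioi fun t (ht : s < t) => ?_
      rw [glue_of_lt _ _ ht, deriv_eq_of_eqOn_open isOpen_Ioi
        (fun x (hx : s < x) => glue_of_lt r u hx) ht]

/-- Coming back close to `-1` from a nonnegative value costs a fixed amount of action. -/
lemma le_lintegral_of_return {a W : ℝ → ℝ} {a₁ μ : ℝ} (ha₁ : 0 ≤ a₁) (ha : ∀ t, a₁ ≤ a t)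
    (hμ0 : 0 ≤ μ) (hμ : ∀ x ∈ Icc (-1 / 2 : ℝ) 0, μ ≤ W x) {u : ℝ → ℝ} (hu : LipschitzWith 1 u)
    {s t₀ : ℝ} (ht₀ : t₀ ≤ s) (h0 : 0 ≤ u t₀) (hs : u s ≤ -1 / 2) :
    ENNReal.ofReal (a₁ * μ / 4) ≤
      ∫⁻ t in Iic s, ENNReal.ofReal (kineticDensity (deriv u t) + a t * W (u t)) := by
  obtain ⟨t₁, ht₁, hut₁⟩ : (-1 / 4 : ℝ) ∈ u '' Icc t₀ s :=
    intermediate_value_Icc' ht₀ hu.continuous.continuousOn ⟨by linarith, by linarith⟩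
  calc
    ENNReal.ofReal (a₁ * μ / 4) = ∫⁻ _ in Icc (t₁ - 1 / 4) t₁, ENNReal.ofReal (a₁ * μ) := by
      rw [setLIntegral_const, Real.volume_Icc, ← ENNReal.ofReal_mul (mul_nonneg ha₁ hμ0)]
      congr 1
      ring
    _ ≤ ∫⁻ t in Icc (t₁ - 1 / 4) t₁,
        ENNReal.ofReal (kineticDensity (deriv u t) + a t * W (u t)) := by
      refine setLIntegral_mono' measurableSet_Icc fun t ht => ENNReal.ofReal_le_ofReal ?_
      have h1 := abs_le.mp (hu.abs_sub_le_of_le ht.2)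
      have h2 : μ ≤ W (u t) := hμ _ ⟨by linarith [h1.2, ht.1], by linarith [h1.1, ht.1]⟩
      have h3 := mul_le_mul (ha t) h2 hμ0 (ha₁.trans (ha t))
      linarith [kineticDensity_nonneg (deriv u t)]
    _ ≤ _ := lintegral_mono_set fun t ht => ht.2.trans ht₁.2

lemma exists_last_time {u : ℝ → ℝ} (hu : Continuous u) (htop : Tendsto u atTop (𝓝 1))
    (hbot : Tendsto u atBot (𝓝 (-1))) {c : ℝ} (hc1 : -1 < c) (hc2 : c < 1) :
    ∃ s, u s = c ∧ ∀ t, s ≤ t → c ≤ u t := by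
  set S := {t | u t ≤ c} with hS
  obtain ⟨R, hR⟩ := eventually_atTop.mp (htop.eventually (lt_mem_nhds hc2))
  have hne : S.Nonempty := (hbot.eventually (ge_mem_nhds hc1)).exists
  have hbdd : BddAbove S := ⟨R, fun t ht => by
    by_contra! h
    exact (hR t h.le).not_ge ht⟩
  have hmem : sSup S ∈ S := (isClosed_le hu continuous_const).csSup_mem hne hbdd
  have hafter : ∀ t, sSup S < t → c < u t := fun t ht => by
    by_contra! h
    exact (le_csSup hbdd h).not_gt ht
  have hle : c ≤ u (sSup S) := by
    refine ge_of_tendsto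
      ((hu.tendsto (sSup S)).mono_left (nhdsWithin_le_nhds (s := Ioi (sSup S)))) ?_
    filter_upwards [self_mem_nhdsWithin] with t ht using (hafter t ht).le
  refine ⟨sSup S, le_antisymm hmem hle, fun t ht => ?_⟩
  rcases ht.eq_or_lt with rfl | h
  · exact hle
  · exact (hafter t h).le

/-- A bounded sequence of `1`-Lipschitz functions has a pointwise convergent subsequence. -/
lemma exists_subseq_tendsto {v : ℕ → ℝ → ℝ} (hv : ∀ n, LipschitzWith 1 (v n))
    (hb : ∀ n t, |v n t| ≤ 1) :
    ∃ φ : ℕ → ℕ, StrictMono φ ∧ ∃ u : ℝ → ℝ, LipschitzWith 1 u ∧ (∀ t, |u t| ≤ 1) ∧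
      ∀ t, Tendsto (fun n => v (φ n) t) atTop (𝓝 (u t)) := by
  have hK : IsCompact (univ.pi fun _ : ℚ => Icc (-1 : ℝ) 1) :=
    isCompact_univ_pi fun _ => isCompact_Icc
  obtain ⟨w, -, φ, hφ, hw⟩ := hK.tendsto_subseq (x := fun n (q : ℚ) => v n q)
    fun n => mem_univ_pi.mpr fun q => abs_le.mp (hb n q)
  rw [tendsto_pi_nhds] at hw
  have hconv : ∀ t, ∃ l, Tendsto (fun n => v (φ n) t) atTop (𝓝 l) := by
    intro t
    refine cauchySeq_tendsto_of_complete (Metric.cauchySeq_iff'.mpr fun ε hε => ?_)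
    obtain ⟨q, hq1, hq2⟩ := exists_rat_btwn (show t < t + ε / 4 by linarith)
    obtain ⟨N, hN⟩ := Metric.cauchySeq_iff'.mp (hw q).cauchySeq (ε / 4) (by linarith)
    refine ⟨N, fun n hn => ?_⟩
    have h1 := hN n hn
    simp only [Function.comp_apply, Real.dist_eq] at h1 ⊢
    have h2 := (hv (φ n)).abs_sub_le_of_le hq1.le
    have h3 := (hv (φ N)).abs_sub_le_of_le hq1.le
    rw [abs_lt] at h1 ⊢
    rw [abs_le] at h2 h3
    constructor <;> linarith [h1.1, h1.2, h2.1, h2.2, h3.1, h3.2]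
  choose u hu using hconv
  refine ⟨φ, hφ, u, lipschitzWith_one_of_le fun s t hst => ?_, fun t => ?_, hu⟩
  · exact le_of_tendsto' ((hu t).sub (hu s)).abs fun n => (hv (φ n)).abs_sub_le_of_le hst
  · exact le_of_tendsto' (hu t).abs fun n => hb _ t

/-- A nonnegative Lipschitz function tends to `0` if an integrable function is bounded below
wherever it is. -/
lemma tendsto_zero_of_integrable {f g : ℝ → ℝ} (hf : Integrable f)
    (hg : LipschitzWith 1 g) (hg0 : ∀ t, 0 ≤ g t) {s : ℝ}
    (h : ∀ η > 0, ∃ c > 0, ∀ t ≥ s, η ≤ g t → c ≤ f t) : Tendsto g atTop (𝓝 0) := by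
  refine tendsto_order.mpr ⟨fun x hx => Eventually.of_forall fun t => hx.trans_le (hg0 t),
    fun η hη => ?_⟩
  obtain ⟨c, hc, hcf⟩ := h (η / 2) (by linarith)
  have hlim := intervalIntegral_tendsto_integral_Ioi s hf.integrableOn tendsto_id
  have hlim2 := intervalIntegral_tendsto_integral_Ioi s hf.integrableOn
    (tendsto_atTop_add_const_right atTop (η / 2) tendsto_id)
  have hdiff := hlim2.sub hlim
  rw [sub_self] at hdiff
  have hsmall := hdiff.eventually (gt_mem_nhds (show 0 < c * (η / 2) by positivity))
  filter_upwards [hsmall, eventually_ge_atTop s] with t ht hst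
  by_contra! hηt
  rw [id, intervalIntegral.integral_interval_sub_left hf.intervalIntegrable
    hf.intervalIntegrable] at ht
  refine absurd ht (not_lt.mpr ?_)
  have hmono := intervalIntegral.integral_mono_on (a := t) (b := t + η / 2) (f := fun _ => c)
    (by linarith) intervalIntegrable_const hf.intervalIntegrable fun r hr => ?_
  · rw [intervalIntegral.integral_const, smul_eq_mul] at hmono
    linarith
  · refine hcf r (hst.trans hr.1) ?_
    linarith [(abs_le.mp (hg.abs_sub_le_of_le hr.1)).1, hr.2]

lemma memX1_of_LaE_lt_top {a W u : ℝ → ℝ} {a₁ δ R : ℝ} (hW : DoubleWell W) (hma : Measurable a)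
    (ha₁ : 0 < a₁) (ha : ∀ t, a₁ ≤ a t) (hu : LipschitzWith 1 u) (hub : ∀ t, |u t| ≤ 1)
    (hfin : LaE a W u < ∞) (hδ : 0 < δ) (hright : ∀ t, R ≤ t → -1 + δ ≤ u t)
    (hleft : ∀ t, t ≤ 0 → u t ≤ 0) : memX1 u := by
  have h0 : ∀ t, 0 ≤ kineticDensity (deriv u t) + a t * W (u t) := fun t =>
    add_nonneg (kineticDensity_nonneg _) (mul_nonneg (ha₁.le.trans (ha t)) (hW.nonneg _))
  have hint : Integrable fun t => kineticDensity (deriv u t) + a t * W (u t) :=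
    ⟨(measurable_lagrangian hma hW.continuous hu.continuous).aestronglyMeasurable, by
      rw [hasFiniteIntegral_iff_ofReal (ae_of_all _ h0)]
      exact hfin⟩
  have hlow : ∀ {μ t}, 0 ≤ μ → μ ≤ W (u t) →
      a₁ * μ ≤ kineticDensity (deriv u t) + a t * W (u t) := fun {μ t} hμ h => by
    linarith [kineticDensity_nonneg (deriv u t), mul_le_mul (ha t) h hμ (ha₁.le.trans (ha t))]
  refine ⟨hu, ?_, ?_⟩
  · have h1 : Tendsto (fun t => 1 - u t) atTop (𝓝 0) := by
      refine tendsto_zero_of_integrable (s := R) hint (lipschitzWith_one_of_le fun s t hst => ?_)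
        (fun t => by linarith [(abs_le.mp (hub t)).2]) fun η hη => ?_
      · rw [show 1 - u t - (1 - u s) = -(u t - u s) by ring, abs_neg]
        exact hu.abs_sub_le_of_le hst
      · obtain ⟨μ, hμ, hμW⟩ := hW.exists_pos_le (x := -1 + δ) (y := 1 - η)
          fun s hs => ⟨by linarith [hs.1] |> fun h : -1 < s => h.ne', by
            linarith [hs.2] |> fun h : s < 1 => h.ne⟩
        exact ⟨a₁ * μ, mul_pos ha₁ hμ, fun t ht hηt =>
          hlow hμ.le (hμW _ ⟨hright t ht, by linarith⟩)⟩
    simpa using h1.const_sub 1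
  · have h1 : Tendsto (fun t => 1 + u (-t)) atTop (𝓝 0) := by
      refine tendsto_zero_of_integrable (s := 0) hint.comp_neg
        (lipschitzWith_one_of_le fun s t hst => ?_)
        (fun t => by linarith [(abs_le.mp (hub (-t))).1]) fun η hη => ?_
      · rw [show 1 + u (-t) - (1 + u (-s)) = -(u (-s) - u (-t)) by ring, abs_neg]
        exact (hu.abs_sub_le_of_le (neg_le_neg hst)).trans_eq (by ring)
      · obtain ⟨μ, hμ, hμW⟩ := hW.exists_pos_le (x := -1 + η) (y := 0)
          fun s hs => ⟨by linarith [hs.1] |> fun h : -1 < s => h.ne', by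
            linarith [hs.2] |> fun h : s < 1 => h.ne⟩
        exact ⟨a₁ * μ, mul_pos ha₁ hμ, fun t ht hηt =>
          hlow hμ.le (hμW _ ⟨by linarith, hleft _ (by linarith)⟩)⟩
    have h2 := (h1.comp tendsto_neg_atBot_atTop).sub_const 1
    simpa [Function.comp_def] using h2

lemma exists_LaE_lt_top {a W : ℝ → ℝ} {a₂ M : ℝ} (hW : DoubleWell W)
    (ha₂ : ∀ t, a t ≤ a₂) (ha : ∀ t, 0 ≤ a t) (hM : ∀ x ∈ Icc (-1 : ℝ) 1, W x ≤ M) :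
    ∃ v, memX1 v ∧ LaE a W v < ∞ := by
  obtain ⟨v, hv, hLa⟩ := exists_ramp_replacement (u := fun _ => (1 : ℝ)) (s := 0) (δ := 2) hW ha₂
    ha hM (LipschitzWith.const _ |>.weaken zero_le_one) tendsto_const_nhds (by norm_num) le_rfl
    (by norm_num)
  refine ⟨v, hv, hLa.trans_lt ?_⟩
  simp [kineticDensity, hW.2.2.1, ENNReal.mul_lt_top]

/-- An almost minimizer stays negative before any time at which it is close to `-1`. -/
lemma neg_of_almost_minimizer {a W : ℝ → ℝ} {a₁ a₂ M μ δ ε : ℝ} {m : ℝ≥0∞} (hW : DoubleWell W)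
    (ha₁ : 0 < a₁) (ha : ∀ t, a₁ ≤ a t ∧ a t ≤ a₂)
    (hM : ∀ x ∈ Icc (-1 : ℝ) 1, W x ≤ M)
    (hμ0 : 0 ≤ μ) (hμ : ∀ x ∈ Icc (-1 / 2 : ℝ) 0, μ ≤ W x) (hδ0 : 0 ≤ δ) (hδ : δ ≤ 1 / 2)
    (hε : 0 ≤ ε) (hsmall : δ * (1 + a₂ * M) + ε < a₁ * μ / 4) (hm : ∀ v, memX1 v → m ≤ LaE a W v)
    (hmfin : m < ∞) {u : ℝ → ℝ} (hu : memX1 u) (hum : LaE a W u ≤ m + ENNReal.ofReal ε) {s : ℝ}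
    (hs : u s = -1 + δ) {t : ℝ} (ht : t ≤ s) : u t < 0 := by
  by_contra! h0
  obtain ⟨v, hv, hLa⟩ := exists_ramp_replacement hW (fun t => (ha t).2)
    (fun t => ha₁.le.trans (ha t).1) hM hu.1 hu.2.1 hδ0 (by linarith) hs
  have hret := le_lintegral_of_return ha₁.le (fun t => (ha t).1) hμ0 hμ hu.1 ht h0
    (by linarith)
  have hsplit := lintegral_add_compl (μ := volume)
    (fun t => ENNReal.ofReal (kineticDensity (deriv u t) + a t * W (u t)))
    (measurableSet_Iic (a := s))
  rw [compl_Iic, ← LaE_eq] at hsplit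
  set J := ∫⁻ t in Ioi s, ENNReal.ofReal (kineticDensity (deriv u t) + a t * W (u t))
  have hLfin : LaE a W u < ∞ := hum.trans_lt (ENNReal.add_lt_top.mpr ⟨hmfin, ENNReal.ofReal_lt_top⟩)
  have hJ : J ≠ ∞ := ne_top_of_le_ne_top hLfin.ne (hsplit ▸ le_add_self)
  have hC : 0 ≤ 1 + a₂ * M := add_nonneg zero_le_one
    (mul_nonneg (ha₁.le.trans ((ha 0).1.trans (ha 0).2))
      ((hW.nonneg 0).trans (hM 0 (by norm_num))))
  have hchain : ENNReal.ofReal (a₁ * μ / 4) + J ≤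
      ENNReal.ofReal (δ * (1 + a₂ * M) + ε) + J := by
    calc
      _ ≤ LaE a W u := hsplit ▸ add_le_add hret le_rfl
      _ ≤ m + ENNReal.ofReal ε := hum
      _ ≤ (ENNReal.ofReal (δ * (1 + a₂ * M)) + J) + ENNReal.ofReal ε :=
        add_le_add ((hm v hv).trans hLa) le_rfl
      _ = _ := by
        rw [ENNReal.ofReal_add (mul_nonneg hδ0 hC) hε]
        ring
  have := ENNReal.le_of_add_le_add_right hJ hchain
  rw [ENNReal.ofReal_le_ofReal_iff (by positivity)] at this
  linarith

lemma tendsto_weight_shift {a b : ℝ → ℝ} {T : ℝ} (hT : 0 < T) (hper : ∀ t : ℝ, b (t + T) = b t)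
    (hlimT : Tendsto (fun t : ℝ => b t - a t) atTop (𝓝 (0:ℝ)))
    (hlimB : Tendsto (fun t : ℝ => b t - a t) atBot (𝓝 (0:ℝ)))
    {k : ℕ → ℤ} (hk : Tendsto k atTop cofinite) (t : ℝ) :
    Tendsto (fun n => a (t + k n * T)) atTop (𝓝 (b t)) := by
  rw [Int.cofinite_eq] at hk
  have hshift : Tendsto (fun n : ℤ => t + n * T) (atBot ⊔ atTop) (atBot ⊔ atTop) :=
    (tendsto_atBot_add_const_left _ t
      ((tendsto_intCast_atBot_iff.mpr tendsto_id).atBot_mul_const hT)).sup_sup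
    (tendsto_atTop_add_const_left _ t (tendsto_intCast_atTop_atTop.atTop_mul_const hT))
  have hdiff := (hlimB.sup hlimT).comp (hshift.comp hk)
  have hp : Function.Periodic b T := hper
  have : ∀ n, a (t + k n * T) = b t - ((fun t => b t - a t) ∘ (fun n : ℤ => t + n * T) ∘ k) n := by
    intro n
    simp only [Function.comp_apply]
    rw [hp.int_mul (k n) t]
    ring
  simp_rw [this]
  simpa using hdiff.const_sub (b t)

/-- The action attains its infimum over `X₁`. -/
lemma exists_minimizer {W a b : ℝ → ℝ} {a₁ a₂ T : ℝ}
    (hW : DoubleWell W) (hma : Measurable a)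
    (ha₁ : 0 < a₁) (ha : ∀ t : ℝ, a₁ ≤ a t ∧ a t ≤ a₂)
    (hmb : Measurable b) (hT : 0 < T) (hper : ∀ t : ℝ, b (t + T) = b t)
    (hab : ∀ t : ℝ, a t ≤ b t)
    (hlimT : Tendsto (fun t : ℝ => b t - a t) atTop (𝓝 (0:ℝ)))
    (hlimB : Tendsto (fun t : ℝ => b t - a t) atBot (𝓝 (0:ℝ))) :
    ∃ u : ℝ → ℝ, memX1 u ∧ (∀ t, |u t| ≤ 1) ∧ LaE a W u < ∞ ∧
      ∀ v : ℝ → ℝ, memX1 v → LaE a W u ≤ LaE a W v := by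
  have ha0 : ∀ t, 0 ≤ a t := fun t => ha₁.le.trans (ha t).1
  obtain ⟨M, hM⟩ : ∃ M, ∀ x ∈ Icc (-1 : ℝ) 1, W x ≤ M := by
    obtain ⟨x, -, hx⟩ := isCompact_Icc.exists_isMaxOn
      (nonempty_Icc.mpr (by norm_num : (-1 : ℝ) ≤ 1))
      hW.continuous.continuousOn
    exact ⟨W x, hx⟩
  obtain ⟨μ, hμ0, hμ⟩ := hW.exists_pos_le (x := -1 / 2) (y := 0) fun s hs =>
    ⟨by rintro rfl; norm_num at hs, by rintro rfl; norm_num at hs⟩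
  have hC : 0 < 1 + a₂ * M := by
    have := mul_nonneg ((ha0 0).trans (ha 0).2) ((hW.nonneg 0).trans (hM 0 (by norm_num)))
    linarith
  set κ := a₁ * μ / 4 with hκ
  have hκ0 : 0 < κ := by positivity
  obtain ⟨δ, hδ0, hδ, hδκ⟩ : ∃ δ > 0, δ ≤ 1 / 2 ∧ δ * (1 + a₂ * M) ≤ κ / 2 := by
    refine ⟨min (1 / 2) (κ / 2 / (1 + a₂ * M)), by positivity, min_le_left _ _, ?_⟩
    rw [← le_div_iff₀ hC]
    exact min_le_right _ _
  set m : ℝ≥0∞ := sInf (LaE a W '' {v | memX1 v}) with hmdef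
  have hm : ∀ v, memX1 v → m ≤ LaE a W v := fun v hv => sInf_le (mem_image_of_mem _ hv)
  have hmfin : m < ∞ := by
    obtain ⟨v, hv, hfin⟩ := exists_LaE_lt_top hW (fun t => (ha t).2) ha0 hM
    exact (hm v hv).trans_lt hfin
  set ε : ℕ → ℝ := fun n => κ / 4 * (1 / ((n : ℝ) + 1)) with hεdef
  have hε0 : ∀ n, 0 < ε n := fun n => by positivity
  have hεlim : Tendsto ε atTop (𝓝 0) := by
    simpa [hεdef] using tendsto_one_div_add_atTop_nhds_zero_nat.const_mul (κ / 4)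
  have hεle : ∀ n, ε n ≤ κ / 4 := fun n =>
    mul_le_of_le_one_right (by positivity) (by
      rw [div_le_one (by positivity)]
      linarith [n.cast_nonneg (α := ℝ)])
  have hseq : ∀ n, ∃ u, memX1 u ∧ (∀ t, |u t| ≤ 1) ∧ LaE a W u ≤ m + ENNReal.ofReal (ε n) := by
    intro n
    obtain ⟨_, ⟨v, hv, rfl⟩, hlt⟩ := exists_lt_of_csInf_lt
      (⟨_, mem_image_of_mem _ (exists_LaE_lt_top hW (fun t => (ha t).2) ha0 hM).choose_spec.1⟩ :
        (LaE a W '' {v | memX1 v}).Nonempty)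
      (ENNReal.lt_add_right hmfin.ne (ENNReal.ofReal_pos.mpr (hε0 n)).ne')
    obtain ⟨w, hw, hwb, hle⟩ := exists_truncation hW ha0 hv
    exact ⟨w, hw, hwb, hle.trans hlt.le⟩
  choose w hw hwb hwm using hseq
  have hs : ∀ n, ∃ s, w n s = -1 + δ ∧ ∀ t, s ≤ t → -1 + δ ≤ w n t := fun n =>
    exists_last_time (hw n).1.continuous (hw n).2.1 (hw n).2.2 (by linarith) (by linarith)
  choose s hs1 hs2 using hs
  set k : ℕ → ℤ := fun n => ⌊s n / T⌋ with hk
  have hk1 : ∀ n, k n * T ≤ s n := fun n => by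
    rw [← le_div_iff₀ hT]
    exact Int.floor_le _
  have hk2 : ∀ n, s n ≤ T + k n * T := fun n => by
    have := (div_le_iff₀ hT).mp (Int.lt_floor_add_one (s n / T)).le
    linarith
  set v : ℕ → ℝ → ℝ := fun n t => w n (t + k n * T) with hv
  have hv1 : ∀ n, LipschitzWith 1 (v n) := fun n => lipschitzWith_one_of_le fun x y hxy =>
    ((hw n).1.abs_sub_le_of_le (by linarith)).trans_eq (by ring)
  obtain ⟨φ, hφ, u, hu1, hub, hu⟩ := exists_subseq_tendsto hv1 fun n t => hwb n _
  have hright : ∀ t, T ≤ t → -1 + δ ≤ u t := fun t ht => ge_of_tendsto' (hu t) fun n =>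
    hs2 _ _ ((hk2 _).trans (by linarith))
  have hleft : ∀ t, t ≤ 0 → u t ≤ 0 := fun t ht => le_of_tendsto' (hu t) fun n =>
    (neg_of_almost_minimizer hW ha₁ ha hM hμ0.le hμ hδ0.le hδ (hε0 _).le
      (by linarith [hεle (φ n)]) hm hmfin (hw (φ n)) (hwm (φ n)) (hs1 (φ n))
      (le_trans (by linarith) (hk1 _))).le
  have hlsc : ∀ (ψ : ℕ → ℕ) (c : ℝ → ℝ), StrictMono ψ → Measurable c →
      (∀ t, Tendsto (fun n => a (t + k (φ (ψ n)) * T)) atTop (𝓝 (c t))) →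
      LaE c W u ≤ m := by
    intro ψ c hψ hc hlim
    refine LaE_le_of_tendsto (α := fun n t => a (t + k (φ (ψ n)) * T))
      (v := fun n => v (φ (ψ n))) hW.continuous hW.nonneg
      (fun n => hma.comp (measurable_id.add_const _)) (fun n t => ha0 _) hc hlim (fun n => hv1 _)
      hu1 (fun t => (hu t).comp hψ.tendsto_atTop) ?_
    have hval : ∀ n, LaE (fun t => a (t + k (φ (ψ n)) * T)) W (v (φ (ψ n))) ≤
        m + ENNReal.ofReal (ε (φ (ψ n))) := fun n =>
      (LaE_comp_add_right a W (w (φ (ψ n))) (k (φ (ψ n)) * T)).trans_le (hwm _)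
    refine (liminf_le_liminf (Eventually.of_forall hval)).trans (le_of_eq ?_)
    refine Tendsto.liminf_eq ?_
    have : Tendsto (fun n => ENNReal.ofReal (ε (φ (ψ n)))) atTop (𝓝 0) := by
      have := (ENNReal.continuous_ofReal.tendsto 0).comp
        (hεlim.comp (hφ.tendsto_atTop.comp hψ.tendsto_atTop))
      simpa [Function.comp_def] using this
    simpa using this.const_add m
  by_cases hcase : ∃ j : ℤ, ∃ᶠ n in atTop, k (φ n) = j
  · obtain ⟨j, hj⟩ := hcase
    obtain ⟨ψ, hψ, hψj⟩ := extraction_of_frequently_atTop hj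
    have hle := hlsc ψ (fun t => a (t + j * T)) hψ (hma.comp (measurable_id.add_const _))
      fun t => by simp only [hψj]; exact tendsto_const_nhds
    have huX : memX1 u := memX1_of_LaE_lt_top hW (hma.comp (measurable_id.add_const (j * T))) ha₁
      (fun t => (ha _).1) hu1 hub (hle.trans_lt hmfin) hδ0 hright hleft
    have heq : LaE a W (fun t => u (t + -(j * T))) ≤ m := by
      rw [← LaE_comp_add_right a W _ (j * T)]
      simpa using hle
    refine ⟨fun t => u (t + -(j * T)), ⟨lipschitzWith_one_of_le fun x y hxy =>
      (hu1.abs_sub_le_of_le (by linarith)).trans_eq (by ring),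
      huX.2.1.comp (tendsto_atTop_add_const_right _ _ tendsto_id),
      huX.2.2.comp (tendsto_atBot_add_const_right _ _ tendsto_id)⟩, fun t => hub _,
      heq.trans_lt hmfin, fun v hv => heq.trans (hm v hv)⟩
  · push Not at hcase
    have hcof : Tendsto (fun n => k (φ n)) atTop cofinite :=
      le_cofinite_iff_eventually_ne.mpr fun j => eventually_map.mpr (hcase j)
    have hle := hlsc id b strictMono_id hmb fun t =>
      tendsto_weight_shift hT hper hlimT hlimB hcof t
    have huX : memX1 u := memX1_of_LaE_lt_top hW hmb ha₁ (fun t => (ha t).1.trans (hab t)) hu1 hub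
      (hle.trans_lt hmfin) hδ0 hright hleft
    have heq : LaE a W u ≤ m := le_trans (lintegral_mono fun t => ENNReal.ofReal_le_ofReal
      (add_le_add le_rfl (mul_le_mul_of_nonneg_right (hab t) (hW.nonneg _)))) hle
    exact ⟨u, huX, hub, heq.trans_lt hmfin, fun v hv => heq.trans (hm v hv)⟩

lemma LipschitzWith.convex_comb {u v : ℝ → ℝ} (hu : LipschitzWith 1 u) (hv : LipschitzWith 1 v)
    {ε : ℝ} (h0 : 0 ≤ ε) (h1 : ε ≤ 1) : LipschitzWith 1 fun t => (1 - ε) * u t + ε * v t := by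
  refine lipschitzWith_one_of_le fun s t hst => ?_
  calc
    _ = |(1 - ε) * (u t - u s) + ε * (v t - v s)| := by ring_nf
    _ ≤ (1 - ε) * (t - s) + ε * (t - s) := by
      refine (abs_add_le _ _).trans (add_le_add ?_ ?_)
      · rw [abs_mul, abs_of_nonneg (sub_nonneg.mpr h1)]
        exact mul_le_mul_of_nonneg_left (hu.abs_sub_le_of_le hst) (sub_nonneg.mpr h1)
      · rw [abs_mul, abs_of_nonneg h0]
        exact mul_le_mul_of_nonneg_left (hv.abs_sub_le_of_le hst) h0
    _ = t - s := by ring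

lemma integrableOn_Icc_of_bound {f : ℝ → ℝ} (hf : Measurable f) {C : ℝ} (hC : ∀ t, |f t| ≤ C)
    (α β : ℝ) : IntegrableOn f (Icc α β) :=
  Measure.integrableOn_of_bounded (by simp) hf.aestronglyMeasurable
    (M := C) (ae_of_all _ hC)

lemma integrableOn_Icc_kineticDensity_deriv (u : ℝ → ℝ) (α β : ℝ) :
    IntegrableOn (fun t => kineticDensity (deriv u t)) (Icc α β) :=
  integrableOn_Icc_of_bound (continuous_kineticDensity.measurable.comp (measurable_deriv u))
    (C := 1) (fun t => by
      rw [Function.comp_apply, abs_of_nonneg (kineticDensity_nonneg _)]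
      exact kineticDensity_le_one _) α β

lemma integrableOn_Icc_mul_continuous {a g : ℝ → ℝ} (hma : Measurable a) {C : ℝ}
    (hC : ∀ t, |a t| ≤ C) (hg : Continuous g) (α β : ℝ) :
    IntegrableOn (fun t => a t * g t) (Icc α β) :=
  (integrableOn_Icc_of_bound hma hC α β).mul_continuousOn hg.continuousOn isCompact_Icc

/-- Comparing actions of curves that agree outside a compact interval. -/
lemma setIntegral_lagrangian_le {a W u z : ℝ → ℝ} {a₂ α β : ℝ} (hW : DoubleWell W)
    (hma : Measurable a) (ha : ∀ t, 0 ≤ a t ∧ a t ≤ a₂) (hu : Continuous u) (hz : Continuous z)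
    (hfin : LaE a W u < ∞) (hle : LaE a W u ≤ LaE a W z) (heq : EqOn z u (Icc α β)ᶜ) :
    ∫ t in Icc α β, (kineticDensity (deriv u t) + a t * W (u t)) ≤
      ∫ t in Icc α β, (kineticDensity (deriv z t) + a t * W (z t)) := by
  have habs : ∀ t, |a t| ≤ a₂ := fun t => by
    rw [abs_of_nonneg (ha t).1]
    exact (ha t).2
  have h0 : ∀ (y : ℝ → ℝ) t, 0 ≤ kineticDensity (deriv y t) + a t * W (y t) := fun y t =>
    add_nonneg (kineticDensity_nonneg _) (mul_nonneg (ha t).1 (hW.nonneg _))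
  have hint : ∀ y : ℝ → ℝ, Continuous y →
      IntegrableOn (fun t => kineticDensity (deriv y t) + a t * W (y t)) (Icc α β) :=
    fun y hy => (integrableOn_Icc_kineticDensity_deriv y α β).add
      (integrableOn_Icc_mul_continuous hma habs (hW.continuous.comp hy) α β)
  have hcompl : ∫⁻ t in (Icc α β)ᶜ, ENNReal.ofReal (kineticDensity (deriv z t) + a t * W (z t)) =
      ∫⁻ t in (Icc α β)ᶜ, ENNReal.ofReal (kineticDensity (deriv u t) + a t * W (u t)) :=
    setLIntegral_congr_fun measurableSet_Icc.compl fun t ht => by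
      rw [heq ht, deriv_eq_of_eqOn_open isClosed_Icc.isOpen_compl heq ht]
  rw [LaE_eq] at hfin
  rw [LaE_eq, LaE_eq, ← lintegral_add_compl _ (measurableSet_Icc (a := α) (b := β)),
    ← lintegral_add_compl (fun t => ENNReal.ofReal (kineticDensity (deriv z t) + a t * W (z t)))
      (measurableSet_Icc (a := α) (b := β)), hcompl] at hle
  have h := ENNReal.le_of_add_le_add_right
    (ne_top_of_le_ne_top hfin.ne (setLIntegral_le_lintegral _ _)) hle
  rw [← ofReal_integral_eq_lintegral_ofReal (hint u hu) (ae_of_all _ (h0 u)),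
    ← ofReal_integral_eq_lintegral_ofReal (hint z hz) (ae_of_all _ (h0 z))] at h
  exact (ENNReal.ofReal_le_ofReal_iff (integral_nonneg (h0 z))).mp h

/-- First-order minimality condition, in the form of a variational inequality. -/
lemma variational_inequality {a W u v : ℝ → ℝ} {a₂ α β : ℝ} (hW : DoubleWell W)
    (hma : Measurable a) (ha : ∀ t, 0 ≤ a t ∧ a t ≤ a₂) (hu : memX1 u) (hfin : LaE a W u < ∞)
    (hmin : ∀ z, memX1 z → LaE a W u ≤ LaE a W z) (hv : LipschitzWith 1 v)
    (heq : EqOn v u (Icc α β)ᶜ) :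
    0 ≤ (∫ t in Icc α β, (kineticDensity (deriv v t) - kineticDensity (deriv u t))) +
      ∫ t in Icc α β, a t * (deriv W (u t) * (v t - u t)) := by
  have habs : ∀ t, |a t| ≤ a₂ := fun t => by
    rw [abs_of_nonneg (ha t).1]
    exact (ha t).2
  have ha₂ : 0 ≤ a₂ := (ha 0).1.trans (ha 0).2
  have huc := hu.1.continuous
  have hvc := hv.continuous
  have hWc := hW.continuous
  have hKu := integrableOn_Icc_kineticDensity_deriv u α β
  have hKv := integrableOn_Icc_kineticDensity_deriv v α β
  have hstep : ∀ ε : ℝ, 0 < ε → ε ≤ 1 →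
      0 ≤ (∫ t in Icc α β, (kineticDensity (deriv v t) - kineticDensity (deriv u t))) +
        ∫ t in Icc α β, a t * (ε⁻¹ * (W (u t + ε * (v t - u t)) - W (u t))) := by
    intro ε h0 h1
    set z : ℝ → ℝ := fun t => (1 - ε) * u t + ε * v t with hz
    have hz1 : LipschitzWith 1 z := hu.1.convex_comb hv h0.le h1
    have hzu : EqOn z u (Icc α β)ᶜ := fun t ht => by
      simp only [hz, heq ht]
      ring
    have hzX : memX1 z := by
      refine ⟨hz1, hu.2.1.congr' ?_, hu.2.2.congr' ?_⟩
      · filter_upwards [eventually_gt_atTop β] with t ht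
        exact (hzu fun h => ht.not_ge h.2).symm
      · filter_upwards [eventually_lt_atBot α] with t ht
        exact (hzu fun h => ht.not_ge h.1).symm
    have hle := setIntegral_lagrangian_le hW hma ha huc hz1.continuous hfin (hmin z hzX) hzu
    have hzform : ∀ t, u t + ε * (v t - u t) = z t := fun t => by simp only [hz]; ring
    have hWu : IntegrableOn (fun t => a t * W (u t)) (Icc α β) :=
      integrableOn_Icc_mul_continuous hma habs (hWc.comp huc) α β
    have hWz : IntegrableOn (fun t => a t * W (z t)) (Icc α β) :=
      integrableOn_Icc_mul_continuous hma habs (hWc.comp hz1.continuous) α β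
    have hconv : ∫ t in Icc α β, (kineticDensity (deriv z t) + a t * W (z t)) ≤
        ∫ t in Icc α β, (((1 - ε) * kineticDensity (deriv u t) + ε * kineticDensity (deriv v t)) +
          a t * W (z t)) := by
      refine integral_mono_ae ((integrableOn_Icc_kineticDensity_deriv z α β).add hWz)
        (((hKu.const_mul _).add (hKv.const_mul _)).add hWz) (ae_restrict_of_ae ?_)
      filter_upwards [hu.1.ae_differentiableAt_real, hv.ae_differentiableAt_real] with t htu htv
      have hd : deriv z t = (1 - ε) * deriv u t + ε * deriv v t :=
        ((htu.hasDerivAt.const_mul (1 - ε)).add (htv.hasDerivAt.const_mul ε)).deriv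
      simp only [hd]
      exact add_le_add (convexOn_kineticDensity.2 (abs_le.mp (hu.1.abs_deriv_le_one t))
        (abs_le.mp (hv.abs_deriv_le_one t)) (by linarith) h0.le (by ring)) le_rfl
    have hle2 := hle.trans hconv
    rw [integral_add (f := fun t => kineticDensity (deriv u t)) hKu hWu,
      integral_add (f := fun t => (1 - ε) * kineticDensity (deriv u t) +
        ε * kineticDensity (deriv v t)) ((hKu.const_mul _).add (hKv.const_mul _)) hWz,
      integral_add (hKu.const_mul _) (hKv.const_mul _), integral_const_mul,
      integral_const_mul] at hle2
    have hsplit : ∫ t in Icc α β, a t * (ε⁻¹ * (W (u t + ε * (v t - u t)) - W (u t))) =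
        ε⁻¹ * ((∫ t in Icc α β, a t * W (z t)) - ∫ t in Icc α β, a t * W (u t)) := by
      rw [← integral_sub hWz hWu, ← integral_const_mul]
      refine integral_congr_ae (ae_of_all _ fun t => ?_)
      simp only [hzform]
      ring
    rw [hsplit, integral_sub hKv hKu]
    have hmul : 0 ≤ ε⁻¹ * (ε * ((∫ t in Icc α β, kineticDensity (deriv v t)) -
        ∫ t in Icc α β, kineticDensity (deriv u t)) +
        ((∫ t in Icc α β, a t * W (z t)) - ∫ t in Icc α β, a t * W (u t))) :=
      mul_nonneg (inv_nonneg.mpr h0.le) (by linarith)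
    rwa [mul_add, inv_mul_cancel_left₀ h0.ne'] at hmul
  obtain ⟨Ru, hRu⟩ := isCompact_Icc.exists_bound_of_continuousOn (s := Icc α β) huc.continuousOn
  obtain ⟨Rv, hRv⟩ := isCompact_Icc.exists_bound_of_continuousOn (s := Icc α β) hvc.continuousOn
  set R := max Ru Rv with hR
  have hdW : Continuous (deriv W) := hW.1.continuous_deriv le_rfl
  obtain ⟨L, hL⟩ := isCompact_Icc.exists_bound_of_continuousOn (s := Icc (-R) R) hdW.continuousOn
  have hWL : ∀ x ∈ Icc (-R) R, ∀ y ∈ Icc (-R) R, |W y - W x| ≤ L * |y - x| := fun x hx y hy =>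
    (convex_Icc (-R) R).norm_image_sub_le_of_norm_deriv_le
      (fun r _ => hW.1.differentiable one_ne_zero r) hL hx hy
  set ε : ℕ → ℝ := fun n => 1 / ((n : ℝ) + 1) with hε
  have hε0 : ∀ n, 0 < ε n := fun n => by positivity
  have hε1 : ∀ n, ε n ≤ 1 := fun n => by
    rw [hε, div_le_one (by positivity)]
    linarith [n.cast_nonneg (α := ℝ)]
  have hεlim : Tendsto ε atTop (𝓝[≠] 0) :=
    tendsto_nhdsWithin_iff.mpr ⟨tendsto_one_div_add_atTop_nhds_zero_nat,
      Eventually.of_forall fun n => (hε0 n).ne'⟩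
  have hdct : Tendsto (fun n => ∫ t in Icc α β,
      a t * ((ε n)⁻¹ * (W (u t + ε n * (v t - u t)) - W (u t)))) atTop
      (𝓝 (∫ t in Icc α β, a t * (deriv W (u t) * (v t - u t)))) := by
    refine tendsto_integral_of_dominated_convergence (fun _ => a₂ * (L * (2 * R))) (fun n => ?_)
      (integrableOn_const (by simp)) (fun n => ?_) (ae_of_all _ fun t => ?_)
    · exact (hma.mul (Continuous.measurable (by fun_prop))).aestronglyMeasurable
    · refine (ae_restrict_iff' measurableSet_Icc).mpr (ae_of_all _ fun t ht => ?_)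
      have hut : |u t| ≤ R := (hRu t ht).trans (le_max_left _ _)
      have hvt : |v t| ≤ R := (hRv t ht).trans (le_max_right _ _)
      have hLn : 0 ≤ L := (norm_nonneg _).trans (hL (u t) (abs_le.mp hut))
      have hzt : u t + ε n * (v t - u t) ∈ Icc (-R) R :=
        (convex_Icc (-R) R).add_smul_sub_mem (abs_le.mp hut) (abs_le.mp hvt)
          ⟨(hε0 n).le, hε1 n⟩
      have hb := hWL _ (abs_le.mp hut) _ hzt
      rw [add_sub_cancel_left, abs_mul, abs_of_pos (hε0 n)] at hb
      have hvu : |v t - u t| ≤ 2 * R := (abs_sub _ _).trans (by linarith)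
      rw [Real.norm_eq_abs, abs_mul, abs_mul, abs_of_pos (inv_pos.mpr (hε0 n))]
      refine mul_le_mul (habs t) ?_ (by positivity) ha₂
      rw [inv_mul_le_iff₀ (hε0 n)]
      nlinarith [mul_le_mul_of_nonneg_left hvu (mul_nonneg hLn (hε0 n).le)]
    · refine Tendsto.const_mul _ ?_
      have hd : HasDerivAt (fun e : ℝ => W (u t + e * (v t - u t)))
          (deriv W (u t) * (v t - u t)) 0 := by
        have h1 : HasDerivAt (fun e : ℝ => u t + e * (v t - u t)) (v t - u t) 0 := by
          simpa using ((hasDerivAt_id (0 : ℝ)).mul_const (v t - u t)).const_add (u t)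
        refine HasDerivAt.comp (h₂ := W) 0 ?_ h1
        simpa using (hW.1.differentiable one_ne_zero (u t)).hasDerivAt
      have := (hasDerivAt_iff_tendsto_slope_zero.mp hd).comp hεlim
      refine this.congr fun n => ?_
      simp
  exact ge_of_tendsto' (hdct.const_add _) fun n => hstep (ε n) (hε0 n) (hε1 n)

lemma lipschitzWith_velocityOfMomentum : LipschitzWith 1 velocityOfMomentum := by
  have hd : ∀ y, HasDerivAt velocityOfMomentum (1 / (Real.sqrt (1 + y ^ 2)) ^ 3) y := by
    intro y
    have h0 : (0 : ℝ) < 1 + y ^ 2 := by positivity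
    have hs : 0 < Real.sqrt (1 + y ^ 2) := Real.sqrt_pos.mpr h0
    have h1 : HasDerivAt (fun y : ℝ => Real.sqrt (1 + y ^ 2))
        ((2 * y) / (2 * Real.sqrt (1 + y ^ 2))) y := by
      refine HasDerivAt.sqrt ?_ h0.ne'
      simpa using (hasDerivAt_pow 2 y).const_add 1
    refine ((hasDerivAt_id y).div h1 hs.ne').congr_deriv ?_
    have hsq := Real.sq_sqrt h0.le
    simp only [id]
    set R := Real.sqrt (1 + y ^ 2)
    field_simp
    linarith
  refine lipschitzWith_of_nnnorm_deriv_le (fun y => (hd y).differentiableAt) fun y => ?_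
  have hs : 1 ≤ Real.sqrt (1 + y ^ 2) := Real.one_le_sqrt.mpr (by nlinarith [sq_nonneg y])
  rw [(hd y).deriv, ← NNReal.coe_le_coe, coe_nnnorm, Real.norm_of_nonneg (by positivity),
    NNReal.coe_one]
  exact (div_le_one (by positivity)).mpr (one_le_pow₀ hs)

/-- The multiplier making `∫ velocityOfMomentum (G + l)` equal to a prescribed subluminal
displacement. -/
lemma exists_multiplier {G : ℝ → ℝ} (hG : Continuous G) {α β d : ℝ} (hd : |d| < β - α) :
    ∃ l, ∫ t in α..β, velocityOfMomentum (G t + l) = d := by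
  have hαβ : 0 < β - α := (abs_nonneg d).trans_lt hd
  have hc : Continuous fun l => ∫ t in α..β, velocityOfMomentum (G t + l) :=
    intervalIntegral.continuous_parametric_intervalIntegral_of_continuous'
      (f := fun l t => velocityOfMomentum (G t + l))
      (continuous_velocityOfMomentum.comp (by fun_prop)) α β
  obtain ⟨M, hM⟩ := isCompact_Icc.exists_bound_of_continuousOn (s := Icc α β) hG.continuousOn
  have hint : ∀ l, IntervalIntegrable (fun t => velocityOfMomentum (G t + l)) volume α β := fun l =>
    (continuous_velocityOfMomentum.comp (hG.add continuous_const)).intervalIntegrable _ _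
  have hconst : ∀ p, |p| < 1 → ∀ c, c = p * (β - α) →
      c = ∫ _ in α..β, velocityOfMomentum (p / Real.sqrt (1 - p ^ 2)) := fun p hp c hcp => by
    rw [intervalIntegral.integral_const, velocityOfMomentum_momentum hp, hcp, smul_eq_mul, mul_comm]
  have hp : |d / (β - α)| < 1 := by
    rw [abs_div, abs_of_pos hαβ, div_lt_one hαβ]
    exact hd
  have heq := hconst _ hp d (by field_simp)
  set y := d / (β - α) / Real.sqrt (1 - (d / (β - α)) ^ 2) with hy
  refine mem_range_of_exists_le_of_exists_ge hc ⟨y - M, ?_⟩ ⟨y + M, ?_⟩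
  · refine le_trans ?_ heq.ge
    refine intervalIntegral.integral_mono_on (by linarith) (hint _) intervalIntegrable_const
      fun t ht => velocityOfMomentum_strictMono.monotone ?_
    linarith [(abs_le.mp (hM t ht)).2]
  · refine heq.le.trans ?_
    refine intervalIntegral.integral_mono_on (by linarith) intervalIntegrable_const (hint _)
      fun t ht => velocityOfMomentum_strictMono.monotone ?_
    linarith [(abs_le.mp (hM t ht)).1]

/-- On a long interval, a minimizer is determined by the Euler–Lagrange equation. -/
lemma eq_integral_of_minimizer {a W u : ℝ → ℝ} {a₂ α β : ℝ} (hW : DoubleWell W)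
    (hma : Measurable a) (ha : ∀ t, 0 ≤ a t ∧ a t ≤ a₂) (hu : memX1 u) (hfin : LaE a W u < ∞)
    (hmin : ∀ z, memX1 z → LaE a W u ≤ LaE a W z) (hub : ∀ t, |u t| ≤ 1)
    (hα : α < -1) (hβ : 1 < β) {G : ℝ → ℝ} (hGc : Continuous G)
    (hG : G = fun t => ∫ r in (0 : ℝ)..t, a r * deriv W (u r)) :
    ∃ l, ∀ t ∈ Icc α β, u t = u α + ∫ r in α..t, velocityOfMomentum (G r + l) := by
  have habs : ∀ t, |a t| ≤ a₂ := fun t => by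
    rw [abs_of_nonneg (ha t).1]
    exact (ha t).2
  have hαβ : α ≤ β := by linarith
  have huc := hu.1.continuous
  have hdW : Continuous (deriv W) := hW.1.continuous_deriv le_rfl
  have hgint : IntervalIntegrable (fun t => a t * deriv W (u t)) volume α β :=
    (intervalIntegrable_iff_integrableOn_Icc_of_le hαβ).mpr
      (integrableOn_Icc_mul_continuous hma habs (hdW.comp huc) α β)
  obtain ⟨l, hl⟩ := exists_multiplier hGc (α := α) (β := β) (d := u β - u α) (by
    have h1 := abs_le.mp (hub α)
    have h2 := abs_le.mp (hub β)
    rw [abs_lt]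
    constructor <;> linarith [h1.1, h1.2, h2.1, h2.2])
  set p : ℝ → ℝ := fun t => velocityOfMomentum (G t + l) with hp
  have hpc : Continuous p := continuous_velocityOfMomentum.comp (hGc.add continuous_const)
  set w : ℝ → ℝ := fun t => u α + ∫ r in α..t, p r with hw
  have hwd : ∀ t, HasDerivAt w (p t) t := fun t =>
    (intervalIntegral.integral_hasDerivAt_right (hpc.intervalIntegrable _ _)
      (hpc.stronglyMeasurableAtFilter _ _) hpc.continuousAt).const_add (u α)
  have hw1 : LipschitzWith 1 w := lipschitzWith_of_nnnorm_deriv_le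
    (fun t => (hwd t).differentiableAt) fun t => by
      rw [(hwd t).deriv, ← NNReal.coe_le_coe, coe_nnnorm, Real.norm_eq_abs, NNReal.coe_one]
      exact (abs_velocityOfMomentum_lt_one _).le
  have hwα : w α = u α := by simp [hw]
  have hwβ : w β = u β := by
    simp only [hw]
    rw [hl]
    ring
  set v : ℝ → ℝ := glue α u (glue β w u) with hv
  have hglueα : u α = glue β w u α := by rw [glue_of_le _ _ hαβ, hwα]
  have hv1 : LipschitzWith 1 v := hu.1.glue (hw1.glue hu.1 hwβ) hglueα
  have hvw : EqOn v w (Icc α β) := fun t ht => by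
    rw [hv, glue_of_ge hglueα ht.1, glue_of_le _ _ ht.2]
  have hvu : EqOn v u (Icc α β)ᶜ := fun t ht => by
    rcases lt_or_ge t α with h | h
    · exact glue_of_le _ _ h.le
    · have hβt : β < t := by
        by_contra! h'
        exact ht ⟨h, h'⟩
      rw [hv, glue_of_ge hglueα h, glue_of_lt _ _ hβt]
  have hvα : v α = u α := (hvw ⟨le_rfl, hαβ⟩).trans hwα
  have hvβ : v β = u β := (hvw ⟨hαβ, le_rfl⟩).trans hwβ
  have hvd : ∀ᵐ t, t ∈ uIoc α β → deriv v t = p t := by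
    have hne : ∀ᵐ t : ℝ, t ≠ β := by simp [ae_iff, measure_singleton]
    filter_upwards [hne] with t ht htm
    rw [uIoc_of_le hαβ] at htm
    rw [deriv_eq_of_eqOn_open isOpen_Ioo (hvw.mono Ioo_subset_Icc_self)
      ⟨htm.1, lt_of_le_of_ne htm.2 ht⟩, (hwd t).deriv]
  have hvi := variational_inequality hW hma ha hu hfin hmin hv1 hvu
  rw [integral_Icc_eq_integral_Ioc, integral_Icc_eq_integral_Ioc,
    ← intervalIntegral.integral_of_le hαβ, ← intervalIntegral.integral_of_le hαβ] at hvi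
  have hu' := hu.1.intervalIntegrable_deriv_real α β
  have hv' := hv1.intervalIntegrable_deriv_real α β
  have hK : ∀ z : ℝ → ℝ, IntervalIntegrable (fun t => kineticDensity (deriv z t)) volume α β :=
    fun z => (intervalIntegrable_iff_integrableOn_Icc_of_le hαβ).mpr
      (integrableOn_Icc_kineticDensity_deriv z α β)
  have hGu := hu'.continuousOn_mul hGc.continuousOn
  have hGv := hv'.continuousOn_mul hGc.continuousOn
  have hparts : ∫ t in α..β, a t * (deriv W (u t) * (v t - u t)) =
      -∫ t in α..β, (G t * deriv v t - G t * deriv u t) := by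
    have hac : AbsolutelyContinuousOnInterval G α β := by
      rw [hG]
      exact hgint.absolutelyContinuousOnInterval_intervalIntegral
        (by rw [uIcc_of_le hαβ]; constructor <;> linarith)
    have hbc : AbsolutelyContinuousOnInterval (fun t => v t - u t) α β :=
      (hv1.lipschitzOnWith (s := uIcc α β)).absolutelyContinuousOnInterval.sub
        (hu.1.lipschitzOnWith (s := uIcc α β)).absolutelyContinuousOnInterval
    have hibp := hac.integral_mul_deriv_eq_deriv_mul hbc
    rw [hvα, hvβ, sub_self, sub_self, mul_zero, mul_zero, sub_zero, zero_sub] at hibp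
    rw [← neg_eq_iff_eq_neg]
    refine Eq.trans ?_ (hibp.symm.trans ?_)
    · congr 1
      refine intervalIntegral.integral_congr_ae ?_
      filter_upwards [hgint.ae_hasDerivAt_integral] with t ht htm
      have := ht (uIoc_subset_uIcc htm) 0 (by rw [uIcc_of_le hαβ]; constructor <;> linarith)
      rw [← hG] at this
      rw [this.deriv]
      ring
    · refine intervalIntegral.integral_congr_ae ?_
      filter_upwards [hv1.ae_differentiableAt_real, hu.1.ae_differentiableAt_real]
        with t htv htu _
      rw [deriv_fun_sub htv htu]
      ring
  rw [hparts, intervalIntegral.integral_sub (hK v) (hK u),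
    intervalIntegral.integral_sub hGv hGu] at hvi
  set D : ℝ → ℝ := fun t => (kineticDensity (deriv u t) - (G t + l) * deriv u t) -
    (kineticDensity (deriv v t) - (G t + l) * deriv v t) with hD
  have hDform : ∀ t, D t = (kineticDensity (deriv u t) - (G t * deriv u t + l * deriv u t)) -
      (kineticDensity (deriv v t) - (G t * deriv v t + l * deriv v t)) := fun t => by
    simp only [hD]
    ring
  have hDintu := (hK u).sub (hGu.add (hu'.const_mul l))
  have hDintv := (hK v).sub (hGv.add (hv'.const_mul l))
  have hDint : IntervalIntegrable D volume α β := (hDintu.sub hDintv).congr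
    fun t _ => (hDform t).symm
  have hDle : ∫ t in α..β, D t ≤ 0 := by
    rw [intervalIntegral.integral_congr (fun t _ => hDform t),
      intervalIntegral.integral_sub hDintu hDintv,
      intervalIntegral.integral_sub (hK u) (hGu.add (hu'.const_mul l)),
      intervalIntegral.integral_sub (hK v) (hGv.add (hv'.const_mul l)),
      intervalIntegral.integral_add hGu (hu'.const_mul l),
      intervalIntegral.integral_add hGv (hv'.const_mul l),
      intervalIntegral.integral_const_mul, intervalIntegral.integral_const_mul,
      hu.1.integral_deriv_eq_sub, hv1.integral_deriv_eq_sub, hvα, hvβ]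
    linarith
  have hD0 : 0 ≤ᵐ[volume.restrict (Ioc α β)] D := by
    refine (ae_restrict_iff' measurableSet_Ioc).mpr ?_
    filter_upwards [hvd] with t ht htm
    rw [uIoc_of_le hαβ] at ht
    simp only [hD, Pi.zero_apply, ht htm]
    linarith [(fenchel_kineticDensity (hu.1.abs_deriv_le_one t) (G t + l)).1]
  have hDzero : D =ᵐ[volume.restrict (Ioc α β)] 0 := by
    rw [intervalIntegral.integral_of_le hαβ] at hDle
    exact (integral_eq_zero_iff_of_nonneg_ae hD0 hDint.1).mp
      (le_antisymm hDle (integral_nonneg_of_ae hD0))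
  have hup : ∀ᵐ t, t ∈ Ioc α β → deriv u t = p t := by
    filter_upwards [(ae_restrict_iff' measurableSet_Ioc).mp hDzero, hvd] with t ht htv htm
    rw [uIoc_of_le hαβ] at htv
    have h0 := ht htm
    simp only [hD, Pi.zero_apply, htv htm] at h0
    exact (fenchel_kineticDensity (hu.1.abs_deriv_le_one t) (G t + l)).2 (by linarith)
  refine ⟨l, fun t ht => ?_⟩
  have hint : ∫ r in α..t, deriv u r = ∫ r in α..t, p r := by
    refine intervalIntegral.integral_congr_ae ?_
    filter_upwards [hup] with r hr hrm
    rw [uIoc_of_le ht.1] at hrm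
    exact hr ⟨hrm.1, hrm.2.trans ht.2⟩
  rw [← hint, hu.1.integral_deriv_eq_sub]
  ring

/-- A convergent function with Lipschitz derivative has derivative tending to `0`. -/
lemma tendsto_deriv_zero {F : Filter ℝ} {f f' : ℝ → ℝ} {l K : ℝ}
    (hF : ∀ h : ℝ, Tendsto (fun t => t + h) F F) (hf : ∀ t, HasDerivAt f (f' t) t)
    (hK0 : 0 ≤ K) (hK : ∀ s t, |f' s - f' t| ≤ K * |s - t|) (hlim : Tendsto f F (𝓝 l)) :
    Tendsto f' F (𝓝 0) := by
  have hbound : ∀ h > 0, ∀ t, |f' t| ≤ |f (t + h) - f t| / h + K * h := by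
    intro h hh t
    obtain ⟨ξ, hξ, hξe⟩ := exists_hasDerivAt_eq_slope f f' (show t < t + h by linarith)
      (fun x _ => (hf x).continuousAt.continuousWithinAt) fun x _ => hf x
    rw [add_sub_cancel_left] at hξe
    have h1 := hK t ξ
    have h2 : |t - ξ| ≤ h := by
      rw [abs_le]
      constructor <;> linarith [hξ.1, hξ.2]
    have h3 : |f' t| ≤ |f' t - f' ξ| + |f' ξ| := by
      simpa using abs_add_le (f' t - f' ξ) (f' ξ)
    have h4 : |f' ξ| = |f (t + h) - f t| / h := by rw [hξe, abs_div, abs_of_pos hh]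
    linarith [mul_le_mul_of_nonneg_left h2 hK0]
  refine Metric.tendsto_nhds.mpr fun η hη => ?_
  set h := η / (2 * (K + 1)) with hh
  have hh0 : 0 < h := by positivity
  have hKh : K * h < η / 2 := by
    rw [hh, mul_div_assoc', div_lt_div_iff₀ (by positivity) two_pos]
    nlinarith
  have hdiff : Tendsto (fun t => |f (t + h) - f t| / h) F (𝓝 0) := by
    simpa using ((hlim.comp (hF h)).sub hlim).abs.div_const h
  filter_upwards [hdiff.eventually (gt_mem_nhds (half_pos hη))] with t ht
  rw [Real.dist_eq, sub_zero]
  linarith [hbound h hh0 t]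

lemma exists_bound_lt_one {f : ℝ → ℝ} (hf : Continuous f) (hlt : ∀ t, |f t| < 1)
    (htop : Tendsto f atTop (𝓝 0)) (hbot : Tendsto f atBot (𝓝 0)) :
    ∃ c, c < 1 ∧ ∀ t, |f t| ≤ c := by
  have hev : ∀ᶠ t in cocompact ℝ, |f t| < 1 / 2 := by
    rw [cocompact_eq_atBot_atTop]
    have := (hbot.sup htop).abs
    rw [abs_zero] at this
    exact this.eventually (gt_mem_nhds (by norm_num))
  obtain ⟨S, hS, hSf⟩ := mem_cocompact.mp hev
  rcases S.eq_empty_or_nonempty with rfl | hne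
  · exact ⟨1 / 2, by norm_num, fun t => (hSf (by simp : t ∈ (∅ : Set ℝ)ᶜ)).le⟩
  · obtain ⟨t₀, -, ht₀⟩ := hS.exists_isMaxOn hne hf.abs.continuousOn
    refine ⟨max (1 / 2) |f t₀|, max_lt (by norm_num) (hlt _), fun t => ?_⟩
    by_cases h : t ∈ S
    · exact (ht₀ h).trans (le_max_right _ _)
    · exact (hSf h).le.trans (le_max_left _ _)

/-- A minimizer has a classical derivative, given by the Euler–Lagrange equation. -/
lemma exists_hasDerivAt_of_minimizer {a W u : ℝ → ℝ} {a₂ : ℝ} (hW : DoubleWell W)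
    (hma : Measurable a) (ha : ∀ t, 0 ≤ a t ∧ a t ≤ a₂) (hu : memX1 u) (hfin : LaE a W u < ∞)
    (hmin : ∀ z, memX1 z → LaE a W u ≤ LaE a W z) (hub : ∀ t, |u t| ≤ 1) {G : ℝ → ℝ}
    (hGc : Continuous G) (hG : G = fun t => ∫ r in (0 : ℝ)..t, a r * deriv W (u r)) :
    ∃ l, ∀ t, HasDerivAt u (velocityOfMomentum (G t + l)) t := by
  have hloc : ∀ N : ℝ, 1 < N → ∃ l, ∀ t ∈ Ioo (-N) N,
      HasDerivAt u (velocityOfMomentum (G t + l)) t := by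
    intro N hN
    obtain ⟨l, hl⟩ := eq_integral_of_minimizer hW hma ha hu hfin hmin hub (neg_lt_neg hN) hN hGc hG
    have hpc : Continuous fun t => velocityOfMomentum (G t + l) :=
      continuous_velocityOfMomentum.comp (hGc.add continuous_const)
    refine ⟨l, fun t ht => ?_⟩
    refine ((intervalIntegral.integral_hasDerivAt_right (hpc.intervalIntegrable (-N) _)
      (hpc.stronglyMeasurableAtFilter _ _) hpc.continuousAt).const_add
        (u (-N))).congr_of_eventuallyEq ?_
    filter_upwards [Icc_mem_nhds ht.1 ht.2] with r hr using hl r hr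
  obtain ⟨l, hl⟩ := hloc 2 one_lt_two
  refine ⟨l, fun t => ?_⟩
  obtain ⟨l', hl'⟩ := hloc (|t| + 2) (by linarith [abs_nonneg t])
  have h0 := (hl 0 (by norm_num)).unique (hl' 0 (by constructor <;> linarith [abs_nonneg t]))
  have hll := add_left_cancel (velocityOfMomentum_injective h0)
  rw [hll]
  exact hl' t ⟨by linarith [neg_abs_le t], by linarith [le_abs_self t]⟩

/-- For a weight satisfying `(a₁)` which is asymptotic from below to a
`T`-periodic `b ∈ L^∞(ℝ)`, `L_a` attains its infimum at some `u_a ∈ X₁`, a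
`C¹ ∩ W^{2,2}_loc` heteroclinic solution with `‖u'‖_{L^∞} < 1`. -/
theorem La_attains_infimum_asymptotically_periodic (W a b : ℝ → ℝ) (a₁ a₂ T : ℝ)
    (hW : DoubleWell W) (hma : Measurable a)
    (ha₁ : 0 < a₁) (ha : ∀ t : ℝ, a₁ ≤ a t ∧ a t ≤ a₂)
    (hmb : Measurable b) (hbbd : ∃ C : ℝ, ∀ᵐ t ∂(volume : Measure ℝ), |b t| ≤ C)
    (hT : 0 < T) (hper : ∀ t : ℝ, b (t + T) = b t)
    (hab : ∀ t : ℝ, a t ≤ b t)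
    (hlimT : Tendsto (fun t : ℝ => b t - a t) atTop (𝓝 (0:ℝ)))
    (hlimB : Tendsto (fun t : ℝ => b t - a t) atBot (𝓝 (0:ℝ))) :
    ∃ u : ℝ → ℝ, memX1 u ∧ (∀ v : ℝ → ℝ, memX1 v → LaE a W u ≤ LaE a W v) ∧
      SolvesEL a W u ∧
      Tendsto u atTop (𝓝 (1:ℝ)) ∧ Tendsto u atBot (𝓝 (-1:ℝ)) ∧
      Tendsto (deriv u) atTop (𝓝 (0:ℝ)) ∧ Tendsto (deriv u) atBot (𝓝 (0:ℝ)) ∧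
      ∃ c : ℝ, c < 1 ∧ ∀ t : ℝ, |deriv u t| ≤ c := by
  obtain ⟨u, hu, hub, hfin, hmin⟩ :=
    exists_minimizer hW hma ha₁ ha hmb hT hper hab hlimT hlimB
  have ha0 : ∀ t, 0 ≤ a t ∧ a t ≤ a₂ := fun t => ⟨ha₁.le.trans (ha t).1, (ha t).2⟩
  have hdW : Continuous (deriv W) := hW.1.continuous_deriv le_rfl
  obtain ⟨L, hL⟩ := isCompact_Icc.exists_bound_of_continuousOn (s := Icc (-1 : ℝ) 1)
    hdW.continuousOn
  have ha₂ : 0 ≤ a₂ := (ha0 0).1.trans (ha0 0).2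
  have hL0 : 0 ≤ L := (norm_nonneg _).trans (hL 0 (by norm_num))
  have hgb : ∀ t, ‖a t * deriv W (u t)‖ ≤ a₂ * L := fun t => by
    rw [norm_mul, Real.norm_of_nonneg (ha0 t).1]
    exact mul_le_mul (ha0 t).2 (hL _ (abs_le.mp (hub t))) (norm_nonneg _) ha₂
  have hgint : ∀ s t, IntervalIntegrable (fun r => a r * deriv W (u r)) volume s t := fun s t =>
    (intervalIntegrable_const (c := a₂ * L)).mono_fun
      (hma.mul (hdW.comp hu.1.continuous).measurable).aestronglyMeasurable
      (ae_of_all _ fun r => (hgb r).trans (le_abs_self _))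
  obtain ⟨G, hG⟩ : ∃ G : ℝ → ℝ, G = fun t => ∫ r in (0 : ℝ)..t, a r * deriv W (u r) := ⟨_, rfl⟩
  have hGdiff : ∀ s t, G t - G s = ∫ r in s..t, a r * deriv W (u r) := fun s t => by
    simp only [hG]
    exact intervalIntegral.integral_interval_sub_left (hgint _ _) (hgint _ _)
  have hGlip : ∀ s t, |G s - G t| ≤ a₂ * L * |s - t| := fun s t => by
    rw [hGdiff]
    exact intervalIntegral.norm_integral_le_of_norm_le_const fun r _ => hgb r
  have hGc : Continuous G := by
    rw [hG]
    exact intervalIntegral.continuous_primitive hgint 0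
  obtain ⟨l, hl⟩ := exists_hasDerivAt_of_minimizer hW hma ha0 hu hfin hmin hub hGc hG
  have hderiv : deriv u = fun t => velocityOfMomentum (G t + l) := funext fun t => (hl t).deriv
  have hdc : Continuous (deriv u) := by
    rw [hderiv]
    exact continuous_velocityOfMomentum.comp (hGc.add continuous_const)
  have hdlip : ∀ s t, |velocityOfMomentum (G s + l) - velocityOfMomentum (G t + l)| ≤
      a₂ * L * |s - t| := fun s t => by
    refine (lipschitzWith_velocityOfMomentum.abs_sub_le _ _).trans ?_
    rw [add_sub_add_right_eq_sub]
    exact hGlip s t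
  have htop : Tendsto (deriv u) atTop (𝓝 0) := by
    rw [hderiv]
    exact tendsto_deriv_zero (fun h => tendsto_atTop_add_const_right _ h tendsto_id) hl
      (mul_nonneg ha₂ hL0) hdlip hu.2.1
  have hbot : Tendsto (deriv u) atBot (𝓝 0) := by
    rw [hderiv]
    exact tendsto_deriv_zero (fun h => tendsto_atBot_add_const_right _ h tendsto_id) hl
      (mul_nonneg ha₂ hL0) hdlip hu.2.2
  refine ⟨u, hu, hmin, ⟨contDiff_one_iff_deriv.mpr ⟨fun t => (hl t).differentiableAt, hdc⟩,
    fun s t => ?_⟩, hu.2.1, hu.2.2, htop, hbot, exists_bound_lt_one hdc (fun t => ?_) htop hbot⟩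
  · simp only [hderiv, momentum_velocityOfMomentum]
    rw [add_sub_add_right_eq_sub, hGdiff]
  · rw [hderiv]
    exact abs_velocityOfMomentum_lt_one _
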